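/- Suppose two cross caps f₀ and f₁ in normal form (with third-order coefficients a_{jk}, b₃ and A_{jk}, B₃ respectively) have the same first fundamental form under a diffeomorphism (u,v) ↦ (x,y) fixing the origin with dx(0,0) = du, dy(0,0) = dv. Then a₀₂ = A₀₂, a₁₁ = A₁₁, a₂₀ = A₂₀, and the combinations a₀₃ + (3/2)a₁₁b₃, a₁₂ + (1+a₁₁²)b₃/(2a₀₂), a₂₁ − a₁₁a₂₀b₃/(6a₀₂), a₃₀ − (1+a₁₁²)a₂₀b₃/(2a₀₂²) coincide with the corresponding combinations in A_{jk}, B₃. -/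

import Mathlib

noncomputable section
open Real Filter

/-- Euclidean dot product on ℝ³ (as ℝ × ℝ × ℝ). -/
def dot3 (a b : ℝ × ℝ × ℝ) : ℝ := a.1 * b.1 + a.2.1 * b.2.1 + a.2.2 * b.2.2

/-- Cross product on ℝ³. -/
def cross3 (a b : ℝ × ℝ × ℝ) : ℝ × ℝ × ℝ :=
  (a.2.1 * b.2.2 - a.2.2 * b.2.1, a.2.2 * b.1 - a.1 * b.2.2, a.1 * b.2.1 - a.2.1 * b.1)

/-- Determinant of three column vectors in ℝ³. -/
def det3 (a b c : ℝ × ℝ × ℝ) : ℝ := dot3 (cross3 a b) c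

/-- Euclidean norm on ℝ³. -/
def norm3 (a : ℝ × ℝ × ℝ) : ℝ := Real.sqrt (dot3 a a)

/-- Partial derivative in the first variable. -/
def p1 {E : Type*} [NormedAddCommGroup E] [NormedSpace ℝ E] (f : ℝ → ℝ → E) (u v : ℝ) : E :=
  deriv (fun t => f t v) u

/-- Partial derivative in the second variable. -/
def p2 {E : Type*} [NormedAddCommGroup E] [NormedSpace ℝ E] (f : ℝ → ℝ → E) (u v : ℝ) : E :=
  deriv (fun t => f u t) v

/-- Third-order cross cap normal form polynomial with coefficients
`a₂₀,a₁₁,a₀₂` (second order), `a₃₀,a₂₁,a₁₂,a₀₃,b₃` (third order). -/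
def ccPoly (a20 a11 a02 a30 a21 a12 a03 b3 : ℝ) (p : ℝ × ℝ) : ℝ × ℝ × ℝ :=
  (p.1,
   p.1 * p.2 + b3 * p.2 ^ 3 / 6,
   a20 * p.1 ^ 2 / 2 + a11 * p.1 * p.2 + a02 * p.2 ^ 2 / 2 +
     a30 * p.1 ^ 3 / 6 + a21 * p.1 ^ 2 * p.2 / 2 + a12 * p.1 * p.2 ^ 2 / 2 +
     a03 * p.2 ^ 3 / 6)

section alg
variable {S : Type*} [CommRing S] [Algebra ℝ S]

/-- all words of length `≤ n` in `U, V` applied to `h` are killed by `ev`. -/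
def Flat18 (U V : Derivation ℝ S S) (ev : S →ₐ[ℝ] ℝ) : ℕ → S → Prop
  | 0, h => ev h = 0
  | n+1, h => ev h = 0 ∧ Flat18 U V ev n (U h) ∧ Flat18 U V ev n (V h)

/-- third component of the normal form -/
def cub18 (a20 a11 a02 a30 a21 a12 a03 : ℝ) (x y : S) : S :=
  (a20/2) • (x*x) + a11 • (x*y) + (a02/2) • (y*y) + (a30/6) • (x*x*x) + (a21/2) • (x*x*y)
    + (a12/2) • (x*y*y) + (a03/6) • (y*y*y)

/-- second component of the normal form -/
def bb18 (b3 : ℝ) (x y : S) : S := x*y + (b3/6) • (y*y*y)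

/-- values of the derivatives up to order three -/
def Jet18 (U V : Derivation ℝ S S) (ev : S →ₐ[ℝ] ℝ) (h : S)
    (h00 h10 h01 h20 h11 h02 h30 h21 h12 h03 : ℝ) : Prop :=
  ev h = h00 ∧ ev (U h) = h10 ∧ ev (V h) = h01 ∧ ev (U (U h)) = h20 ∧ ev (U (V h)) = h11
  ∧ ev (V (V h)) = h02 ∧ ev (U (U (U h))) = h30 ∧ ev (U (U (V h))) = h21
  ∧ ev (U (V (V h))) = h12 ∧ ev (V (V (V h))) = h03

variable (U V : Derivation ℝ S S) (ev : S →ₐ[ℝ] ℝ)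

theorem jet_mul18 {h k : S} {h00 h10 h01 h20 h11 h02 h30 h21 h12 h03 : ℝ}
    {k00 k10 k01 k20 k11 k02 k30 k21 k12 k03 : ℝ}
    (Hh : Jet18 U V ev h h00 h10 h01 h20 h11 h02 h30 h21 h12 h03)
    (Hk : Jet18 U V ev k k00 k10 k01 k20 k11 k02 k30 k21 k12 k03)
    (hc : ∀ a, V (U a) = U (V a)) :
    Jet18 U V ev (h*k) (h00*k00) (h10*k00+h00*k10) (h01*k00+h00*k01)
      (h20*k00+2*h10*k10+h00*k20) (h11*k00+h10*k01+h01*k10+h00*k11)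
      (h02*k00+2*h01*k01+h00*k02)
      (h30*k00+3*h20*k10+3*h10*k20+h00*k30)
      (h21*k00+h20*k01+2*h11*k10+2*h10*k11+h01*k20+h00*k21)
      (h12*k00+h02*k10+2*h11*k01+2*h01*k11+h10*k02+h00*k12)
      (h03*k00+3*h02*k01+3*h01*k02+h00*k03) := by
  obtain ⟨h1,h2,h3,h4,h5,h6,h7,h8,h9,h10⟩ := Hh
  obtain ⟨k1,k2,k3,k4,k5,k6,k7,k8,k9,k10⟩ := Hk
  refine ⟨?_,?_,?_,?_,?_,?_,?_,?_,?_,?_⟩ <;>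
  simp only [map_add, map_mul, Derivation.leibniz, smul_eq_mul, hc, *] <;> ring

theorem jet_add18 {h k : S} {h00 h10 h01 h20 h11 h02 h30 h21 h12 h03 : ℝ}
    {k00 k10 k01 k20 k11 k02 k30 k21 k12 k03 : ℝ}
    (Hh : Jet18 U V ev h h00 h10 h01 h20 h11 h02 h30 h21 h12 h03)
    (Hk : Jet18 U V ev k k00 k10 k01 k20 k11 k02 k30 k21 k12 k03) :
    Jet18 U V ev (h+k) (h00+k00) (h10+k10) (h01+k01) (h20+k20) (h11+k11) (h02+k02)
      (h30+k30) (h21+k21) (h12+k12) (h03+k03) := by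
  obtain ⟨h1,h2,h3,h4,h5,h6,h7,h8,h9,h10⟩ := Hh
  obtain ⟨k1,k2,k3,k4,k5,k6,k7,k8,k9,k10⟩ := Hk
  refine ⟨?_,?_,?_,?_,?_,?_,?_,?_,?_,?_⟩ <;>
  simp only [map_add, *]

theorem jet_smul18 {h : S} (c : ℝ) {h00 h10 h01 h20 h11 h02 h30 h21 h12 h03 : ℝ}
    (Hh : Jet18 U V ev h h00 h10 h01 h20 h11 h02 h30 h21 h12 h03) :
    Jet18 U V ev (c • h) (c*h00) (c*h10) (c*h01) (c*h20) (c*h11) (c*h02)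
      (c*h30) (c*h21) (c*h12) (c*h03) := by
  obtain ⟨h1,h2,h3,h4,h5,h6,h7,h8,h9,h10⟩ := Hh
  refine ⟨?_,?_,?_,?_,?_,?_,?_,?_,?_,?_⟩ <;>
  simp only [map_smul, Derivation.map_smul, smul_eq_mul, *]

theorem jet_flat18 {h : S} (H : Flat18 U V ev 3 h) : Jet18 U V ev h 0 0 0 0 0 0 0 0 0 0 := by
  simp only [Flat18] at H
  simp only [Jet18]
  tauto

/-- jets of the derivatives of `h`, the fourth-order values being left abstract -/
theorem jet_U18 {h : S} {h00 h10 h01 h20 h11 h02 h30 h21 h12 h03 : ℝ}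
    (Hh : Jet18 U V ev h h00 h10 h01 h20 h11 h02 h30 h21 h12 h03)
    (hc : ∀ a, V (U a) = U (V a)) :
    Jet18 U V ev (U h) h10 h20 h11 h30 h21 h12 (ev (U (U (U (U h))))) (ev (U (U (U (V h)))))
      (ev (U (U (V (V h))))) (ev (U (V (V (V h))))) := by
  obtain ⟨h1,h2,h3,h4,h5,h6,h7,h8,h9,h10⟩ := Hh
  refine ⟨?_,?_,?_,?_,?_,?_,?_,?_,?_,?_⟩ <;>
  simp only [hc, *]

theorem jet_V18 {h : S} {h00 h10 h01 h20 h11 h02 h30 h21 h12 h03 : ℝ}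
    (Hh : Jet18 U V ev h h00 h10 h01 h20 h11 h02 h30 h21 h12 h03)  :
    Jet18 U V ev (V h) h01 h11 h02 h21 h12 h03 (ev (U (U (U (V h)))))
      (ev (U (U (V (V h))))) (ev (U (V (V (V h))))) (ev (V (V (V (V h))))) := by
  obtain ⟨h1,h2,h3,h4,h5,h6,h7,h8,h9,h10⟩ := Hh
  refine ⟨?_,?_,?_,?_,?_,?_,?_,?_,?_,?_⟩ <;>
  simp only [*]

/-- two elements with equal jets -/
theorem jet_unique18 {h k : S} {h00 h10 h01 h20 h11 h02 h30 h21 h12 h03 : ℝ}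
    {k00 k10 k01 k20 k11 k02 k30 k21 k12 k03 : ℝ}
    (Hh : Jet18 U V ev h h00 h10 h01 h20 h11 h02 h30 h21 h12 h03)
    (Hk : Jet18 U V ev k k00 k10 k01 k20 k11 k02 k30 k21 k12 k03)
    (H : Flat18 U V ev 3 (h-k)) :
    h00=k00 ∧ h10=k10 ∧ h01=k01 ∧ h20=k20 ∧ h11=k11 ∧ h02=k02 ∧ h30=k30 ∧ h21=k21 ∧ h12=k12
      ∧ h03=k03 := by
  obtain ⟨h1,h2,h3,h4,h5,h6,h7,h8,h9,h10⟩ := Hh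
  obtain ⟨k1,k2,k3,k4,k5,k6,k7,k8,k9,k10⟩ := Hk
  have := jet_flat18 U V ev H
  simp only [Jet18, map_sub, sub_eq_zero, *] at this
  exact this

theorem alg18 (hc : ∀ a, V (U a) = U (V a))
    (a20 a11 a02 a30 a21 a12 a03 b3 : ℝ) (ha02 : 0 < a02)
    (A20 A11 A02 A30 A21 A12 A03 B3 : ℝ) (hA02 : 0 < A02)
    (u v x y r1 r2 r3 s1 s2 s3 : S)
    (hr1 : Flat18 U V ev 3 r1) (hr2 : Flat18 U V ev 3 r2) (hr3 : Flat18 U V ev 3 r3)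
    (hs1 : Flat18 U V ev 3 s1) (hs2 : Flat18 U V ev 3 s2) (hs3 : Flat18 U V ev 3 s3)
    (hu : ev u = 0) (hv : ev v = 0) (huu : U u = 1) (hvu : V u = 0) (huv : U v = 0)
    (hvv : V v = 1)
    (hx : ev x = 0) (hy : ev y = 0) (hux : ev (U x) = 1) (hvx : ev (V x) = 0)
    (huy : ev (U y) = 0) (hvy : ev (V y) = 1)
    (f1 f2 f3 g1 g2 g3 : S)
    (hf1 : f1 = u + r1) (hf2 : f2 = bb18 b3 u v + r2)
    (hf3 : f3 = cub18 a20 a11 a02 a30 a21 a12 a03 u v + r3)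
    (hg1 : g1 = x + s1) (hg2 : g2 = bb18 B3 x y + s2)
    (hg3 : g3 = cub18 A20 A11 A02 A30 A21 A12 A03 x y + s3)
    (hE : Flat18 U V ev 3 ((U f1 * U f1 + U f2 * U f2 + U f3 * U f3) -
      (U g1 * U g1 + U g2 * U g2 + U g3 * U g3)))
    (hF : Flat18 U V ev 3 ((U f1 * V f1 + U f2 * V f2 + U f3 * V f3) -
      (U g1 * V g1 + U g2 * V g2 + U g3 * V g3)))
    (hG : Flat18 U V ev 3 ((V f1 * V f1 + V f2 * V f2 + V f3 * V f3) -
      (V g1 * V g1 + V g2 * V g2 + V g3 * V g3))) :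
    a02 = A02 ∧ a11 = A11 ∧ a20 = A20 ∧
      a03 + 3 * a11 * b3 / 2 = A03 + 3 * A11 * B3 / 2 ∧
      a12 + (1 + a11 ^ 2) * b3 / (2 * a02) = A12 + (1 + A11 ^ 2) * B3 / (2 * A02) ∧
      a21 - a11 * a20 * b3 / (6 * a02) = A21 - A11 * A20 * B3 / (6 * A02) ∧
      a30 - (1 + a11 ^ 2) * a20 * b3 / (2 * a02 ^ 2) =
        A30 - (1 + A11 ^ 2) * A20 * B3 / (2 * A02 ^ 2) := by
  have Ju : Jet18 U V ev u 0 1 0 0 0 0 0 0 0 0 := by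
    simp [Jet18, *]
  have Jv : Jet18 U V ev v 0 0 1 0 0 0 0 0 0 0 := by
    simp [Jet18, *]
  obtain ⟨x20, x11, x02, x30, x21, x12, x03, Jx⟩ : ∃ x20 x11 x02 x30 x21 x12 x03,
      Jet18 U V ev x 0 1 0 x20 x11 x02 x30 x21 x12 x03 :=
    ⟨_, _, _, _, _, _, _, hx, hux, hvx, rfl, rfl, rfl, rfl, rfl, rfl, rfl⟩
  obtain ⟨y20, y11, y02, y30, y21, y12, y03, Jy⟩ : ∃ y20 y11 y02 y30 y21 y12 y03,
      Jet18 U V ev y 0 0 1 y20 y11 y02 y30 y21 y12 y03 :=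
    ⟨_, _, _, _, _, _, _, hy, huy, hvy, rfl, rfl, rfl, rfl, rfl, rfl, rfl⟩
  have bbJ : ∀ (b : ℝ) (x y r : S) (x20 x11 x02 x30 x21 x12 x03 y20 y11 y02 y30 y21 y12 y03 : ℝ),
      Flat18 U V ev 3 r → Jet18 U V ev x 0 1 0 x20 x11 x02 x30 x21 x12 x03 →
      Jet18 U V ev y 0 0 1 y20 y11 y02 y30 y21 y12 y03 → 
      Jet18 U V ev (bb18 b x y + r) 0 0 0 0 1 0 (3*y20) (x20+2*y11) (2*x11+y02) (3*x02+b) := by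
    intro b x y r x20 x11 x02 x30 x21 x12 x03 y20 y11 y02 y30 y21 y12 y03 hr hx hy
    have := jet_add18 U V ev (jet_add18 U V ev (jet_mul18 U V ev hx hy hc)
      (jet_smul18 U V ev (b/6) (jet_mul18 U V ev (jet_mul18 U V ev hy hy hc) hy hc)))
      (jet_flat18 U V ev hr)
    unfold bb18
    convert this using 1 <;> ring
  have cubJ : ∀ (a20 a11 a02 a30 a21 a12 a03 : ℝ) (x y r : S)
      (x20 x11 x02 x30 x21 x12 x03 y20 y11 y02 y30 y21 y12 y03 : ℝ),
      Flat18 U V ev 3 r → Jet18 U V ev x 0 1 0 x20 x11 x02 x30 x21 x12 x03 →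
      Jet18 U V ev y 0 0 1 y20 y11 y02 y30 y21 y12 y03 → 
      Jet18 U V ev (cub18 a20 a11 a02 a30 a21 a12 a03 x y + r) 0 0 0 a20 a11 a02
        (3*a20*x20 + a11*(3*y20) + a30) 
        (2*a20*x11 + a11*(x20+2*y11) + a02*y20 + a21)
        (a20*x02 + a11*(2*x11+y02) + 2*a02*y11 + a12) 
        (a11*(3*x02) + 3*a02*y02 + a03) := by
    intro a20 a11 a02 a30 a21 a12 a03 x y r
      x20 x11 x02 x30 x21 x12 x03 y20 y11 y02 y30 y21 y12 y03 hr hx hy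
    have xx := jet_mul18 U V ev hx hx hc
    have xy := jet_mul18 U V ev hx hy hc
    have yy := jet_mul18 U V ev hy hy hc
    have xxx := jet_mul18 U V ev xx hx hc
    have xxy := jet_mul18 U V ev xx hy hc
    have xyy := jet_mul18 U V ev xy hy hc
    have yyy := jet_mul18 U V ev yy hy hc
    have := jet_add18 U V ev (jet_add18 U V ev (jet_add18 U V ev (jet_add18 U V ev
      (jet_add18 U V ev (jet_add18 U V ev (jet_add18 U V ev
      (jet_smul18 U V ev (a20/2) xx) (jet_smul18 U V ev a11 xy)) (jet_smul18 U V ev (a02/2) yy))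
      (jet_smul18 U V ev (a30/6) xxx)) (jet_smul18 U V ev (a21/2) xxy))
      (jet_smul18 U V ev (a12/2) xyy)) (jet_smul18 U V ev (a03/6) yyy)) (jet_flat18 U V ev hr)
    unfold cub18
    convert this using 1 <;> ring
  have Jf1 := jet_add18 U V ev Ju (jet_flat18 U V ev hr1)
  have Jf2 := bbJ b3 _ _ _ _ _ _ _ _ _ _ _ _ _ _ _ _ _ hr2 Ju Jv
  have Jf3 := cubJ a20 a11 a02 a30 a21 a12 a03 _ _ _ _ _ _ _ _ _ _ _ _ _ _ _ _ _ hr3 Ju Jv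
  have Jg1 := jet_add18 U V ev Jx (jet_flat18 U V ev hs1)
  have Jg2 := bbJ B3 _ _ _ _ _ _ _ _ _ _ _ _ _ _ _ _ _ hs2 Jx Jy
  have Jg3 := cubJ A20 A11 A02 A30 A21 A12 A03 _ _ _ _ _ _ _ _ _ _ _ _ _ _ _ _ _ hs3 Jx Jy
  rw [← hf1] at Jf1; rw [← hf2] at Jf2; rw [← hf3] at Jf3
  rw [← hg1] at Jg1; rw [← hg2] at Jg2; rw [← hg3] at Jg3
  have EQ := jet_unique18 U V ev
    (jet_add18 U V ev (jet_add18 U V ev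
      (jet_mul18 U V ev (jet_U18 U V ev Jf1 hc) (jet_U18 U V ev Jf1 hc) hc)
      (jet_mul18 U V ev (jet_U18 U V ev Jf2 hc) (jet_U18 U V ev Jf2 hc) hc))
      (jet_mul18 U V ev (jet_U18 U V ev Jf3 hc) (jet_U18 U V ev Jf3 hc) hc))
    (jet_add18 U V ev (jet_add18 U V ev
      (jet_mul18 U V ev (jet_U18 U V ev Jg1 hc) (jet_U18 U V ev Jg1 hc) hc)
      (jet_mul18 U V ev (jet_U18 U V ev Jg2 hc) (jet_U18 U V ev Jg2 hc) hc))
      (jet_mul18 U V ev (jet_U18 U V ev Jg3 hc) (jet_U18 U V ev Jg3 hc) hc)) hE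
  have FQ := jet_unique18 U V ev
    (jet_add18 U V ev (jet_add18 U V ev
      (jet_mul18 U V ev (jet_U18 U V ev Jf1 hc) (jet_V18 U V ev Jf1) hc)
      (jet_mul18 U V ev (jet_U18 U V ev Jf2 hc) (jet_V18 U V ev Jf2) hc))
      (jet_mul18 U V ev (jet_U18 U V ev Jf3 hc) (jet_V18 U V ev Jf3) hc))
    (jet_add18 U V ev (jet_add18 U V ev
      (jet_mul18 U V ev (jet_U18 U V ev Jg1 hc) (jet_V18 U V ev Jg1) hc)
      (jet_mul18 U V ev (jet_U18 U V ev Jg2 hc) (jet_V18 U V ev Jg2) hc))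
      (jet_mul18 U V ev (jet_U18 U V ev Jg3 hc) (jet_V18 U V ev Jg3) hc)) hF
  have GQ := jet_unique18 U V ev
    (jet_add18 U V ev (jet_add18 U V ev
      (jet_mul18 U V ev (jet_V18 U V ev Jf1) (jet_V18 U V ev Jf1) hc)
      (jet_mul18 U V ev (jet_V18 U V ev Jf2) (jet_V18 U V ev Jf2) hc))
      (jet_mul18 U V ev (jet_V18 U V ev Jf3) (jet_V18 U V ev Jf3) hc))
    (jet_add18 U V ev (jet_add18 U V ev
      (jet_mul18 U V ev (jet_V18 U V ev Jg1) (jet_V18 U V ev Jg1) hc)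
      (jet_mul18 U V ev (jet_V18 U V ev Jg2) (jet_V18 U V ev Jg2) hc))
      (jet_mul18 U V ev (jet_V18 U V ev Jg3) (jet_V18 U V ev Jg3) hc)) hG
  clear hE hF hG bbJ cubJ
  generalize ev (U (U (U (U f1)))) = m40 at *
  generalize ev (U (U (U (V f1)))) = m31 at *
  generalize ev (U (U (V (V f1)))) = m22 at *
  generalize ev (U (V (V (V f1)))) = m13 at *
  generalize ev (V (V (V (V f1)))) = m04 at *
  generalize ev (U (U (U (U g1)))) = n40 at *
  generalize ev (U (U (U (V g1)))) = n31 at *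
  generalize ev (U (U (V (V g1)))) = n22 at *
  generalize ev (U (V (V (V g1)))) = n13 at *
  generalize ev (V (V (V (V g1)))) = n04 at *
  simp only [mul_zero, zero_mul, add_zero, zero_add, mul_one, one_mul] at EQ FQ GQ
  obtain ⟨-, e10, e01, e20, e11, e02, e30, e21, e12, e03⟩ := EQ
  obtain ⟨-, k10, k01, k20, k11, k02, k30, k21, k12, k03⟩ := FQ
  obtain ⟨-, -, -, g20, g11, g02, g30, g21, g12, g03⟩ := GQ
  have X20 : x20 = 0 := by linarith
  have X11 : x11 = 0 := by linarith
  have X02 : x02 = 0 := by linarith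
  subst X20 X11 X02
  simp only [mul_zero, zero_mul, add_zero, zero_add, mul_one, one_mul] at *
  clear Jf1 Jf2 Jf3 Jg1 Jg2 Jg3 Jx Jy Ju Jv
  have c1 : a02 = A02 := by
    have : (a02 - A02) * (a02 + A02) = 0 := by linarith
    rcases mul_eq_zero.1 this with h | h <;> linarith
  subst c1
  have hne : a02 ≠ 0 := ha02.ne'
  have c2 : a11 = A11 := mul_right_cancel₀ hne (by linarith)
  subst c2
  have X12 : x12 = 0 := by linarith
  have c3 : a20 = A20 := mul_right_cancel₀ hne (by linarith)
  subst c3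
  have d03 : A03 = a03 - 3 * a02 * y02 := mul_right_cancel₀ hne (by linarith)
  have d21 : A21 = a21 - 2 * a11 * y11 - a02 * y20 := by
    subst d03
    exact mul_right_cancel₀ hne (by linarith)
  have q0 : y11 = 0 := by
    subst d21
    linarith
  subst q0
  obtain ⟨t, ht⟩ : ∃ t, A12 = a12 - a11 * y02 - a02 * t :=
    ⟨(a12 - a11 * y02 - A12) / a02, by field_simp; ring⟩
  subst d03 d21 ht
  have hr : y02 = a11 * a02 * t := by linarith
  have hB : B3 = b3 + 2 * a02 ^ 2 * t := by linarith
  have hz : A30 = a30 - 3 * a11 * y20 + a20 * t := mul_right_cancel₀ hne (by linarith)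
  subst hr hB hz
  have hp : y20 = - a11 * a20 * t / 3 := by linarith
  subst hp
  refine ⟨rfl, rfl, rfl, ?_, ?_, ?_, ?_⟩ <;> field_simp <;> ring
end alg

section ana
open scoped ContDiff

/-- the algebra of smooth functions on the plane -/
def Sm18 : Subalgebra ℝ (ℝ × ℝ → ℝ) where
  carrier := {f | ContDiff ℝ ∞ f}
  mul_mem' := fun {a b} (ha : ContDiff ℝ ∞ a) (hb : ContDiff ℝ ∞ b) =>
    show ContDiff ℝ ∞ (a * b) from ha.mul hb
  add_mem' := fun {a b} (ha : ContDiff ℝ ∞ a) (hb : ContDiff ℝ ∞ b) =>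
    show ContDiff ℝ ∞ (a + b) from ha.add hb
  algebraMap_mem' := fun r => show ContDiff ℝ ∞ (fun _ : ℝ × ℝ => r) from contDiff_const

theorem smooth18 (h : Sm18) : ContDiff ℝ ∞ h.1 := h.2

/-- directional derivative -/
def D18 (w : ℝ × ℝ) : Derivation ℝ Sm18 Sm18 :=
  Derivation.mk'
    { toFun := fun h => ⟨fun p => fderiv ℝ h.1 p w,
        ((smooth18 h).fderiv_right (m := ∞) (by simp)).clm_apply contDiff_const⟩
      map_add' := fun a b => by
        apply Subtype.ext
        funext p
        have ha : DifferentiableAt ℝ a.1 p := ((smooth18 a).differentiable (by simp)).differentiableAt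
        have hb : DifferentiableAt ℝ b.1 p := ((smooth18 b).differentiable (by simp)).differentiableAt
        have := congrArg (fun L => L w) (fderiv_add ha hb)
        exact this
      map_smul' := fun c a => by
        apply Subtype.ext
        funext p
        have ha : DifferentiableAt ℝ a.1 p := ((smooth18 a).differentiable (by simp)).differentiableAt
        have := congrArg (fun L => L w) (fderiv_const_smul ha c)
        exact this }
    (fun a b => by
        apply Subtype.ext
        funext p
        have ha : DifferentiableAt ℝ a.1 p := ((smooth18 a).differentiable (by simp)).differentiableAt
        have hb : DifferentiableAt ℝ b.1 p := ((smooth18 b).differentiable (by simp)).differentiableAt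
        have := congrArg (fun L => L w) (fderiv_mul ha hb)
        exact this)

theorem D18_apply (w : ℝ × ℝ) (h : Sm18) (p : ℝ × ℝ) : (D18 w h).1 p = fderiv ℝ h.1 p w := rfl

/-- evaluation at the origin -/
def ev18 : Sm18 →ₐ[ℝ] ℝ := (Pi.evalAlgHom ℝ (fun _ : ℝ × ℝ => ℝ) (0,0)).comp Sm18.val

theorem ev18_apply (h : Sm18) : ev18 h = h.1 (0,0) := rfl

theorem D18_comm (w w' : ℝ × ℝ) (h : Sm18) : D18 w (D18 w' h) = D18 w' (D18 w h) := by
  apply Subtype.ext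
  funext p
  have hd : DifferentiableAt ℝ (fderiv ℝ h.1) p :=
    (((smooth18 h).fderiv_right (m := ∞) (by simp)).differentiable (by simp)).differentiableAt
  have key : ∀ w w' : ℝ × ℝ, (D18 w (D18 w' h)).1 p = fderiv ℝ (fderiv ℝ h.1) p w w' := by
    intro w w'
    have := (hd.hasFDerivAt.clm_apply (hasFDerivAt_const w' p)).fderiv
    have := congrArg (fun L => L w) this
    rw [D18_apply]
    change fderiv ℝ (fun y => fderiv ℝ h.1 y w') p w = _
    simpa using this
  rw [key, key]
  exact ((smooth18 h).contDiffAt.isSymmSndFDerivAt (by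
    rw [minSmoothness_of_isRCLikeNormedField]
    exact WithTop.coe_le_coe.2 (le_top : (2:ℕ∞) ≤ ⊤))) w w'

theorem flat18_of_iter (n : ℕ) : ∀ h : Sm18, (∀ k ≤ n, iteratedFDeriv ℝ k h.1 (0,0) = 0) →
    Flat18 (D18 (1,0)) (D18 (0,1)) ev18 n h := by
  have base : ∀ h : Sm18, iteratedFDeriv ℝ 0 h.1 (0,0) = 0 → ev18 h = 0 := by
    intro h h0
    have := congrArg (fun L => L 0) h0
    rw [ev18_apply]
    simpa using this
  have step : ∀ (w : ℝ × ℝ) (h : Sm18) (k : ℕ), iteratedFDeriv ℝ (k+1) h.1 (0,0) = 0 →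
      iteratedFDeriv ℝ k (D18 w h).1 (0,0) = 0 := by
    intro w h k hk
    have hs : ContDiff ℝ ∞ (fderiv ℝ h.1) := (smooth18 h).fderiv_right (m := ∞) (by simp)
    have := norm_iteratedFDeriv_clm_apply_const (c := w) (n := k) (x := ((0:ℝ),(0:ℝ))) (N := ∞)
      hs.contDiffAt (by exact_mod_cast le_top)
    rw [norm_iteratedFDeriv_fderiv, hk, norm_zero, mul_zero] at this
    exact norm_le_zero_iff.1 this
  induction n with
  | zero => exact fun h hh => base h (hh 0 le_rfl)
  | succ n ih =>
    intro h hh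
    exact ⟨base h (hh 0 (by omega)), ih _ fun k hk => step _ _ _ (hh _ (by omega)),
      ih _ fun k hk => step _ _ _ (hh _ (by omega))⟩

theorem flat18_of_eventually (n : ℕ) : ∀ h : Sm18, (∀ᶠ p in nhds ((0:ℝ),(0:ℝ)), h.1 p = 0) →
    Flat18 (D18 (1,0)) (D18 (0,1)) ev18 n h := by
  intro h hh
  apply flat18_of_iter
  intro k _
  have : h.1 =ᶠ[nhds ((0:ℝ),(0:ℝ))] fun _ => (0:ℝ) := hh
  have := (this.iteratedFDeriv ℝ k).eq_of_nhds
  rw [this]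
  exact congrFun (iteratedFDeriv_fun_zero (𝕜 := ℝ) (n := k)) _

theorem iter_lin18 {F G : Type*} [NormedAddCommGroup F] [NormedSpace ℝ F]
    [NormedAddCommGroup G] [NormedSpace ℝ G] (L : F →L[ℝ] G)
    (R : ℝ × ℝ → F) (hR : ContDiff ℝ ∞ R) (k : ℕ) (h : iteratedFDeriv ℝ k R (0,0) = 0) :
    iteratedFDeriv ℝ k (fun p => L (R p)) (0,0) = 0 := by
  have := L.iteratedFDeriv_comp_left (x := ((0:ℝ),(0:ℝ))) (i := k) hR.contDiffAt
    (by exact_mod_cast le_top)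
  change iteratedFDeriv ℝ k (L ∘ R) (0,0) = 0
  rw [this, h]
  ext; simp

theorem iter_comp18 {F : Type*} [NormedAddCommGroup F] [NormedSpace ℝ F]
    (R : ℝ × ℝ → F) (hR : ContDiff ℝ ∞ R) (φ : ℝ × ℝ → ℝ × ℝ) (hφ : ContDiff ℝ ∞ φ)
    (hφ0 : φ (0, 0) = (0, 0)) (n : ℕ) (h : ∀ k ≤ n, iteratedFDeriv ℝ k R (0,0) = 0) :
    ∀ k ≤ n, iteratedFDeriv ℝ k (fun p => R (φ p)) (0,0) = 0 := by
  intro k hk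
  have := norm_iteratedFDeriv_comp_le (n := k) (C := 0)
    (D := 1 + ∑ i ∈ Finset.range (k+1), ‖iteratedFDeriv ℝ i φ (0,0)‖) hR hφ
    (by exact_mod_cast le_top) (0,0)
    (fun i hi => by rw [hφ0, h i (hi.trans hk), norm_zero]) (fun i hi hik => by
      have h1 : ‖iteratedFDeriv ℝ i φ (0,0)‖ ≤
          ∑ i ∈ Finset.range (k+1), ‖iteratedFDeriv ℝ i φ (0,0)‖ :=
        Finset.single_le_sum (f := fun i => ‖iteratedFDeriv ℝ i φ (0,0)‖)
          (fun _ _ => norm_nonneg _) (Finset.mem_range.2 (by omega))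
      have h2 : (1:ℝ) ≤ 1 + ∑ i ∈ Finset.range (k+1), ‖iteratedFDeriv ℝ i φ (0,0)‖ := by
        have := (norm_nonneg _).trans h1
        linarith
      have h3 := le_self_pow₀ h2 (by omega : i ≠ 0)
      linarith)
  rw [mul_zero, zero_mul] at this
  exact norm_le_zero_iff.1 this

/-- first coordinate of ℝ³ -/
def L1 : ℝ × ℝ × ℝ →L[ℝ] ℝ := ContinuousLinearMap.fst ℝ ℝ (ℝ × ℝ)
/-- second coordinate of ℝ³ -/
def L2 : ℝ × ℝ × ℝ →L[ℝ] ℝ :=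
  (ContinuousLinearMap.fst ℝ ℝ ℝ).comp (ContinuousLinearMap.snd ℝ ℝ (ℝ × ℝ))
/-- third coordinate of ℝ³ -/
def L3 : ℝ × ℝ × ℝ →L[ℝ] ℝ :=
  (ContinuousLinearMap.snd ℝ ℝ ℝ).comp (ContinuousLinearMap.snd ℝ ℝ (ℝ × ℝ))

/-- a linear functional of a smooth map as an element of the algebra -/
def mk18 {F : Type*} [NormedAddCommGroup F] [NormedSpace ℝ F] (L : F →L[ℝ] ℝ)
    (H : ℝ × ℝ → F) (hH : ContDiff ℝ ∞ H) : Sm18 :=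
  ⟨fun p => L (H p), L.contDiff.comp hH⟩

theorem D18_mk {F : Type*} [NormedAddCommGroup F] [NormedSpace ℝ F] (L : F →L[ℝ] ℝ)
    (H : ℝ × ℝ → F) (hH : ContDiff ℝ ∞ H) (w p : ℝ × ℝ) :
    (D18 w (mk18 L H hH)).1 p = L (fderiv ℝ H p w) := by
  have hd : DifferentiableAt ℝ H p := (hH.differentiable (by simp)).differentiableAt
  have := (L.hasFDerivAt.comp p hd.hasFDerivAt).fderiv
  exact congrArg (fun M => M w) this

theorem dot18 (H : ℝ × ℝ → ℝ × ℝ × ℝ) (hH : ContDiff ℝ ∞ H) (w w' p : ℝ × ℝ) :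
    (D18 w (mk18 L1 H hH) * D18 w' (mk18 L1 H hH) + D18 w (mk18 L2 H hH) * D18 w' (mk18 L2 H hH)
      + D18 w (mk18 L3 H hH) * D18 w' (mk18 L3 H hH)).1 p
    = dot3 (fderiv ℝ H p w) (fderiv ℝ H p w') := by
  change (D18 w (mk18 L1 H hH)).1 p * (D18 w' (mk18 L1 H hH)).1 p
    + (D18 w (mk18 L2 H hH)).1 p * (D18 w' (mk18 L2 H hH)).1 p
    + (D18 w (mk18 L3 H hH)).1 p * (D18 w' (mk18 L3 H hH)).1 p = _
  simp only [D18_mk]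
  rfl

theorem flat_mk18 (L : ℝ × ℝ × ℝ →L[ℝ] ℝ) (R : ℝ × ℝ → ℝ × ℝ × ℝ) (hR : ContDiff ℝ ∞ R)
    (h : ∀ k ≤ 3, iteratedFDeriv ℝ k R (0,0) = 0) :
    Flat18 (D18 (1,0)) (D18 (0,1)) ev18 3 (mk18 L R hR) :=
  flat18_of_iter 3 _ fun k hk => iter_lin18 L R hR k (h k hk)

theorem ccPoly_smooth18 (a20 a11 a02 a30 a21 a12 a03 b3 : ℝ) :
    ContDiff ℝ ∞ (ccPoly a20 a11 a02 a30 a21 a12 a03 b3) := by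
  unfold ccPoly
  fun_prop
end ana

/-- if two cross caps in normal form (up to an `O(4)` remainder)
have the same first fundamental form under a diffeomorphism fixing the origin
with identity differential there, then `a₀₂, a₁₁, a₂₀` and the four third-order
combinations coincide. -/
theorem stmt_18
    (a20 a11 a02 a30 a21 a12 a03 b3 : ℝ) (ha02 : 0 < a02)
    (A20 A11 A02 A30 A21 A12 A03 B3 : ℝ) (hA02 : 0 < A02)
    (R0 R1 : ℝ × ℝ → ℝ × ℝ × ℝ)
    (hR0 : ContDiff ℝ (⊤ : ℕ∞) R0) (hR1 : ContDiff ℝ (⊤ : ℕ∞) R1)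
    (hR0' : ∀ k : ℕ, k ≤ 3 → iteratedFDeriv ℝ k R0 (0, 0) = 0)
    (hR1' : ∀ k : ℕ, k ≤ 3 → iteratedFDeriv ℝ k R1 (0, 0) = 0)
    (φ : ℝ × ℝ → ℝ × ℝ) (hφ : ContDiff ℝ (⊤ : ℕ∞) φ) (hφ0 : φ (0, 0) = (0, 0))
    (hφ1 : fderiv ℝ φ (0, 0) = ContinuousLinearMap.id ℝ (ℝ × ℝ)) :
    let f0 : ℝ × ℝ → ℝ × ℝ × ℝ :=
      fun p => ccPoly a20 a11 a02 a30 a21 a12 a03 b3 p + R0 p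
    let f1 : ℝ × ℝ → ℝ × ℝ × ℝ :=
      fun p => ccPoly A20 A11 A02 A30 A21 A12 A03 B3 p + R1 p
    (∀ᶠ p in nhds ((0:ℝ), (0:ℝ)), ∀ w w' : ℝ × ℝ,
        dot3 (fderiv ℝ f0 p w) (fderiv ℝ f0 p w') =
          dot3 (fderiv ℝ f1 (φ p) (fderiv ℝ φ p w))
               (fderiv ℝ f1 (φ p) (fderiv ℝ φ p w'))) →
    a02 = A02 ∧ a11 = A11 ∧ a20 = A20 ∧
      a03 + 3 * a11 * b3 / 2 = A03 + 3 * A11 * B3 / 2 ∧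
      a12 + (1 + a11 ^ 2) * b3 / (2 * a02) = A12 + (1 + A11 ^ 2) * B3 / (2 * A02) ∧
      a21 - a11 * a20 * b3 / (6 * a02) = A21 - A11 * A20 * B3 / (6 * A02) ∧
      a30 - (1 + a11 ^ 2) * a20 * b3 / (2 * a02 ^ 2) =
        A30 - (1 + A11 ^ 2) * A20 * B3 / (2 * A02 ^ 2) := by
  intro f0 f1 heq
  have hf0 : ContDiff ℝ (⊤ : ℕ∞) f0 := (ccPoly_smooth18 _ _ _ _ _ _ _ _).add hR0
  have hf1 : ContDiff ℝ (⊤ : ℕ∞) f1 := (ccPoly_smooth18 _ _ _ _ _ _ _ _).add hR1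
  have hg : ContDiff ℝ (⊤ : ℕ∞) (fun p => f1 (φ p)) := hf1.comp hφ
  have hs : ContDiff ℝ (⊤ : ℕ∞) (fun p => R1 (φ p)) := hR1.comp hφ
  have hs' := iter_comp18 R1 hR1 φ hφ hφ0 3 hR1'
  have hchain : ∀ p w, fderiv ℝ (fun p => f1 (φ p)) p w = fderiv ℝ f1 (φ p) (fderiv ℝ φ p w) := by
    intro p w
    have h1 : DifferentiableAt ℝ f1 (φ p) := (hf1.differentiable (by simp)).differentiableAt
    have h2 : DifferentiableAt ℝ φ p := (hφ.differentiable (by simp)).differentiableAt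
    exact congrArg (fun M => M w) (fderiv_comp p h1 h2)
  have hmain : ∀ w w' : ℝ × ℝ, Flat18 (D18 (1,0)) (D18 (0,1)) ev18 3
      ((D18 w (mk18 L1 f0 hf0) * D18 w' (mk18 L1 f0 hf0)
        + D18 w (mk18 L2 f0 hf0) * D18 w' (mk18 L2 f0 hf0)
        + D18 w (mk18 L3 f0 hf0) * D18 w' (mk18 L3 f0 hf0))
      - (D18 w (mk18 L1 _ hg) * D18 w' (mk18 L1 _ hg)
        + D18 w (mk18 L2 _ hg) * D18 w' (mk18 L2 _ hg)
        + D18 w (mk18 L3 _ hg) * D18 w' (mk18 L3 _ hg))) := by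
    intro w w'
    apply flat18_of_eventually
    filter_upwards [heq] with p hp
    have h1 := dot18 f0 hf0 w w' p
    have h2 := dot18 _ hg w w' p
    rw [hchain, hchain, ← hp w w', ← h1] at h2
    exact sub_eq_zero.2 h2.symm
  have hid : ContDiff ℝ (⊤ : ℕ∞) (fun p : ℝ × ℝ => p) := contDiff_id
  refine alg18 (D18 (1,0)) (D18 (0,1)) ev18 (fun a => D18_comm _ _ a)
    a20 a11 a02 a30 a21 a12 a03 b3 ha02 A20 A11 A02 A30 A21 A12 A03 B3 hA02
    (mk18 (ContinuousLinearMap.fst ℝ ℝ ℝ) _ hid) (mk18 (ContinuousLinearMap.snd ℝ ℝ ℝ) _ hid)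
    (mk18 (ContinuousLinearMap.fst ℝ ℝ ℝ) φ hφ) (mk18 (ContinuousLinearMap.snd ℝ ℝ ℝ) φ hφ)
    (mk18 L1 R0 hR0) (mk18 L2 R0 hR0) (mk18 L3 R0 hR0)
    (mk18 L1 _ hs) (mk18 L2 _ hs) (mk18 L3 _ hs)
    (flat_mk18 _ _ _ hR0') (flat_mk18 _ _ _ hR0') (flat_mk18 _ _ _ hR0')
    (flat_mk18 _ _ _ hs') (flat_mk18 _ _ _ hs') (flat_mk18 _ _ _ hs')
    rfl rfl ?_ ?_ ?_ ?_ ?_ ?_ ?_ ?_ ?_ ?_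
    (mk18 L1 f0 hf0) (mk18 L2 f0 hf0) (mk18 L3 f0 hf0)
    (mk18 L1 _ hg) (mk18 L2 _ hg) (mk18 L3 _ hg)
    ?_ ?_ ?_ ?_ ?_ ?_ (hmain _ _) (hmain _ _) (hmain _ _)
  · exact Subtype.ext (funext fun p => by rw [D18_mk, fderiv_fun_id]; rfl)
  · exact Subtype.ext (funext fun p => by rw [D18_mk, fderiv_fun_id]; rfl)
  · exact Subtype.ext (funext fun p => by rw [D18_mk, fderiv_fun_id]; rfl)
  · exact Subtype.ext (funext fun p => by rw [D18_mk, fderiv_fun_id]; rfl)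
  · exact congrArg Prod.fst hφ0
  · exact congrArg Prod.snd hφ0
  · rw [ev18_apply, D18_mk, hφ1]; rfl
  · rw [ev18_apply, D18_mk, hφ1]; rfl
  · rw [ev18_apply, D18_mk, hφ1]; rfl
  · rw [ev18_apply, D18_mk, hφ1]; rfl
  · rfl
  · refine Subtype.ext (funext fun p => ?_)
    change p.1 * p.2 + b3 * p.2 ^ 3 / 6 + (R0 p).2.1 =
      p.1 * p.2 + (b3/6) * (p.2*p.2*p.2) + (R0 p).2.1
    ring
  · refine Subtype.ext (funext fun p => ?_)
    change a20 * p.1 ^ 2 / 2 + a11 * p.1 * p.2 + a02 * p.2 ^ 2 / 2 +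
      a30 * p.1 ^ 3 / 6 + a21 * p.1 ^ 2 * p.2 / 2 + a12 * p.1 * p.2 ^ 2 / 2 +
      a03 * p.2 ^ 3 / 6 + (R0 p).2.2 =
      (a20/2) * (p.1*p.1) + a11 * (p.1*p.2) + (a02/2) * (p.2*p.2) + (a30/6) * (p.1*p.1*p.1)
      + (a21/2) * (p.1*p.1*p.2) + (a12/2) * (p.1*p.2*p.2) + (a03/6) * (p.2*p.2*p.2) + (R0 p).2.2
    ring
  · rfl
  · refine Subtype.ext (funext fun p => ?_)
    change (φ p).1 * (φ p).2 + B3 * (φ p).2 ^ 3 / 6 + (R1 (φ p)).2.1 =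
      (φ p).1 * (φ p).2 + (B3/6) * ((φ p).2*(φ p).2*(φ p).2) + (R1 (φ p)).2.1
    ring
  · refine Subtype.ext (funext fun q => ?_)
    change A20 * (φ q).1 ^ 2 / 2 + A11 * (φ q).1 * (φ q).2 + A02 * (φ q).2 ^ 2 / 2 +
      A30 * (φ q).1 ^ 3 / 6 + A21 * (φ q).1 ^ 2 * (φ q).2 / 2 + A12 * (φ q).1 * (φ q).2 ^ 2 / 2 +
      A03 * (φ q).2 ^ 3 / 6 + (R1 (φ q)).2.2 =
      (A20/2) * ((φ q).1*(φ q).1) + A11 * ((φ q).1*(φ q).2) + (A02/2) * ((φ q).2*(φ q).2)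
      + (A30/6) * ((φ q).1*(φ q).1*(φ q).1)
      + (A21/2) * ((φ q).1*(φ q).1*(φ q).2) + (A12/2) * ((φ q).1*(φ q).2*(φ q).2)
      + (A03/6) * ((φ q).2*(φ q).2*(φ q).2) + (R1 (φ q)).2.2
    ring
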